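/- Let ε be a splitting on an open set U ⊆ ℝⁿ. Then the algebroid curvature is the linearization of the groupoid curvature along the diagonal: for every x ∈ U and v ∈ ℝⁿ, the function t ↦ R^i_{jk}(x, x + t v) (defined for all sufficiently small t) is differentiable at t = 0 with derivative (d/dt)|_{t=0} R^i_{jk}(x, x + t v) = 𝔯^i_{jk,a}(x) v^a. In particular, R ≡ 0 implies 𝔯 ≡ 0. -/

import Mathlib

noncomputable section

open Set

/-- The `j`-th coordinate partial derivative of a real-valued function on `ℝⁿ`. -/
noncomputable def pd {n : ℕ} (j : Fin n) (f : (Fin n → ℝ) → ℝ) (x : Fin n → ℝ) : ℝ :=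
  fderiv ℝ f x (Pi.single j 1)

/-- A splitting `ε` on `U`: a smooth groupoid homomorphism `U × U → GL(n,ℝ)`
satisfying `ε(z,y)ε(x,z) = ε(x,y)` and `ε(x,x) = id`. -/
structure IsSplitting {n : ℕ} (U : Set (Fin n → ℝ))
    (eps : (Fin n → ℝ) → (Fin n → ℝ) → Fin n → Fin n → ℝ) : Prop where
  smooth : ∀ i j : Fin n, ContDiffOn ℝ (⊤ : ℕ∞)
    (fun p : (Fin n → ℝ) × (Fin n → ℝ) => eps p.1 p.2 i j) (U ×ˢ U)
  comp : ∀ x ∈ U, ∀ y ∈ U, ∀ z ∈ U, ∀ i j : Fin n,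
    (∑ a, eps z y i a * eps x z a j) = eps x y i j
  refl : ∀ x ∈ U, ∀ i j : Fin n, eps x x i j = if i = j then (1 : ℝ) else 0

/-- `Γ^i_{jk}(x) = (∂ε^i_k(x,y)/∂y^j)|_{y=x}`. -/
noncomputable def Gam {n : ℕ} (eps : (Fin n → ℝ) → (Fin n → ℝ) → Fin n → Fin n → ℝ)
    (i j k : Fin n) (x : Fin n → ℝ) : ℝ :=
  pd j (fun y => eps x y i k) x

/-- The groupoid curvature `R^i_{jk}(x,y)`. -/
noncomputable def Rg {n : ℕ} (eps : (Fin n → ℝ) → (Fin n → ℝ) → Fin n → Fin n → ℝ)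
    (i j k : Fin n) (x y : Fin n → ℝ) : ℝ :=
  pd j (fun x' => eps x' y i k) x + ∑ a, pd a (fun y' => eps x y' i k) y * eps x y a j
    - pd k (fun x' => eps x' y i j) x - ∑ a, pd a (fun y' => eps x y' i j) y * eps x y a k

/-- The algebroid curvature `𝔯^i_{jk,r}(x)`. -/
noncomputable def ra {n : ℕ} (eps : (Fin n → ℝ) → (Fin n → ℝ) → Fin n → Fin n → ℝ)
    (i j k r : Fin n) (x : Fin n → ℝ) : ℝ :=
  pd j (Gam eps i r k) x + ∑ a, Gam eps a r j x * Gam eps i a k x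
    - pd k (Gam eps i r j) x - ∑ a, Gam eps a r k x * Gam eps i a j x

/-- The torsion `T^i_{jk} = Γ^i_{jk} − Γ^i_{kj}`. -/
noncomputable def Tor {n : ℕ} (eps : (Fin n → ℝ) → (Fin n → ℝ) → Fin n → Fin n → ℝ)
    (i j k : Fin n) (x : Fin n → ℝ) : ℝ :=
  Gam eps i j k x - Gam eps i k j x

/-- A vector field `ξ` is `ε`-parallel if `ξ^i(y) = ε^i_a(x,y) ξ^a(x)` for all `x, y ∈ U`. -/
def EpsParallelVF {n : ℕ} (U : Set (Fin n → ℝ))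
    (eps : (Fin n → ℝ) → (Fin n → ℝ) → Fin n → Fin n → ℝ)
    (ξ : (Fin n → ℝ) → Fin n → ℝ) : Prop :=
  ∀ x ∈ U, ∀ y ∈ U, ∀ i, ξ y i = ∑ a, eps x y i a * ξ x a

theorem pd_fst_eq_fderiv {n : ℕ} {f : (Fin n → ℝ) × (Fin n → ℝ) → ℝ} {x y : Fin n → ℝ}
    (hf : DifferentiableAt ℝ f (x, y)) (j : Fin n) :
    pd j (fun x' => f (x', y)) x = fderiv ℝ f (x, y) (Pi.single j 1, 0) := by
  have h := HasFDerivAt.comp x hf.hasFDerivAt (hasFDerivAt_prodMk_left (𝕜 := ℝ) x y)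
  have h' : fderiv ℝ (fun x' => f (x', y)) x = _ := h.fderiv
  simp [pd, h']

theorem pd_snd_eq_fderiv {n : ℕ} {f : (Fin n → ℝ) × (Fin n → ℝ) → ℝ} {x y : Fin n → ℝ}
    (hf : DifferentiableAt ℝ f (x, y)) (j : Fin n) :
    pd j (fun y' => f (x, y')) y = fderiv ℝ f (x, y) (0, Pi.single j 1) := by
  have h := HasFDerivAt.comp y hf.hasFDerivAt (hasFDerivAt_prodMk_right (𝕜 := ℝ) x y)
  have h' : fderiv ℝ (fun y' => f (x, y')) y = _ := h.fderiv
  simp [pd, h']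

theorem hasDerivAt_prodMk_add_smul {E : Type*} [NormedAddCommGroup E] [NormedSpace ℝ E]
    (x v : E) : HasDerivAt (fun t : ℝ => (x, x + t • v)) (0, v) 0 := by
  have h : HasDerivAt (fun t : ℝ => x + t • v) ((1 : ℝ) • v) 0 :=
    ((hasDerivAt_id (0 : ℝ)).smul_const v).const_add x
  rw [one_smul] at h
  exact (hasDerivAt_const (0 : ℝ) x).prodMk h

theorem HasFDerivAt.hasDerivAt_prodMk_add_smul {E F : Type*} [NormedAddCommGroup E]
    [NormedSpace ℝ E] [NormedAddCommGroup F] [NormedSpace ℝ F] {g : E × E → F}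
    {g' : E × E →L[ℝ] F} {x : E} (hg : HasFDerivAt g g' (x, x)) (v : E) :
    HasDerivAt (fun t : ℝ => g (x, x + t • v)) (g' (0, v)) 0 :=
  HasFDerivAt.comp_hasDerivAt_of_eq (0 : ℝ) hg (_root_.hasDerivAt_prodMk_add_smul x v) (by simp)

theorem ContinuousLinearMap.sum_apply_zero_single_mul {n : ℕ}
    (L : (Fin n → ℝ) × (Fin n → ℝ) →L[ℝ] ℝ) (v : Fin n → ℝ) :
    ∑ a, L (0, Pi.single a 1) * v a = L (0, v) := by
  have h : (L.comp (ContinuousLinearMap.inr ℝ _ _)) v = _ :=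
    LinearMap.pi_apply_eq_sum_univ (L.comp (ContinuousLinearMap.inr ℝ _ _)).toLinearMap v
  have hs (a : Fin n) : (fun b => if a = b then (1 : ℝ) else 0) = Pi.single a 1 := by
    ext b
    simp [Pi.single_apply, eq_comm]
  simpa [hs, mul_comm] using h.symm

namespace IsSplitting

variable {n : ℕ} {U : Set (Fin n → ℝ)} {eps : (Fin n → ℝ) → (Fin n → ℝ) → Fin n → Fin n → ℝ}

theorem contDiffAt (heps : IsSplitting U eps) (hU : IsOpen U) {x y : Fin n → ℝ} (hx : x ∈ U)
    (hy : y ∈ U) (i j : Fin n) :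
    ContDiffAt ℝ 2 (fun p : (Fin n → ℝ) × (Fin n → ℝ) => eps p.1 p.2 i j) (x, y) :=
  ((heps.smooth i j).contDiffAt ((hU.prod hU).mem_nhds ⟨hx, hy⟩)).of_le (WithTop.coe_le_coe.2 (le_top : (2 : ℕ∞) ≤ ⊤))

theorem differentiableAt (heps : IsSplitting U eps) (hU : IsOpen U) {x y : Fin n → ℝ}
    (hx : x ∈ U) (hy : y ∈ U) (i j : Fin n) :
    DifferentiableAt ℝ (fun p : (Fin n → ℝ) × (Fin n → ℝ) => eps p.1 p.2 i j) (x, y) :=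
  (heps.contDiffAt hU hx hy i j).differentiableAt (by norm_num)

theorem hasFDerivAt_fderiv (heps : IsSplitting U eps) (hU : IsOpen U) {x : Fin n → ℝ}
    (hx : x ∈ U) (i j : Fin n) :
    HasFDerivAt (fderiv ℝ (fun p : (Fin n → ℝ) × (Fin n → ℝ) => eps p.1 p.2 i j))
      (fderiv ℝ (fderiv ℝ (fun p : (Fin n → ℝ) × (Fin n → ℝ) => eps p.1 p.2 i j)) (x, x))
      (x, x) :=
  (((heps.contDiffAt hU hx hx i j).fderiv_right (m := 1) (by norm_num)).differentiableAt
    (by norm_num)).hasFDerivAt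

theorem gam_eq (heps : IsSplitting U eps) (hU : IsOpen U) {x : Fin n → ℝ} (hx : x ∈ U)
    (i j k : Fin n) :
    Gam eps i j k x =
      fderiv ℝ (fun p : (Fin n → ℝ) × (Fin n → ℝ) => eps p.1 p.2 i k) (x, x)
        (0, Pi.single j 1) :=
  pd_snd_eq_fderiv (heps.differentiableAt hU hx hx i k) j

theorem pd_gam_eq (heps : IsSplitting U eps) (hU : IsOpen U) {x : Fin n → ℝ} (hx : x ∈ U)
    (i j k r : Fin n) :
    pd j (Gam eps i r k) x =
      fderiv ℝ (fderiv ℝ (fun p : (Fin n → ℝ) × (Fin n → ℝ) => eps p.1 p.2 i k)) (x, x)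
        (0, Pi.single r 1) (Pi.single j 1, Pi.single j 1) := by
  have heq : Gam eps i r k =ᶠ[nhds x] fun y =>
      fderiv ℝ (fun p : (Fin n → ℝ) × (Fin n → ℝ) => eps p.1 p.2 i k) (y, y)
        (0, Pi.single r 1) := by
    filter_upwards [hU.mem_nhds hx] with y hy using heps.gam_eq hU hy i r k
  have hd : HasFDerivAt (fun y : Fin n → ℝ => (y, y)) _ x :=
    (hasFDerivAt_id (𝕜 := ℝ) x).prodMk (hasFDerivAt_id x)
  have h := (HasFDerivAt.comp (f := fun y => (y, y)) x (heps.hasFDerivAt_fderiv hU hx i k) hd).clm_apply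
    (hasFDerivAt_const ((0, Pi.single r 1) : (Fin n → ℝ) × (Fin n → ℝ)) x)
  have hsymm : IsSymmSndFDerivAt ℝ
      (fun p : (Fin n → ℝ) × (Fin n → ℝ) => eps p.1 p.2 i k) (x, x) :=
    (heps.contDiffAt hU hx hx i k).isSymmSndFDerivAt (by simp)
  have h' := (h.congr_of_eventuallyEq heq).fderiv
  rw [hsymm.eq]
  simp [pd, h']

/-- The derivative along `y = x + t v` of the half of the groupoid curvature that is
antisymmetrized. -/
theorem hasDerivAt_half_curvature (heps : IsSplitting U eps) (hU : IsOpen U) {x : Fin n → ℝ}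
    (hx : x ∈ U) (v : Fin n → ℝ) (i j k : Fin n) :
    HasDerivAt (fun t : ℝ => pd j (fun x' => eps x' (x + t • v) i k) x +
        ∑ a, pd a (fun y' => eps x y' i k) (x + t • v) * eps x (x + t • v) a j)
      (∑ r, (pd j (Gam eps i r k) x + ∑ a, Gam eps a r j x * Gam eps i a k x) * v r) 0 := by
  have hmem : ∀ᶠ t : ℝ in nhds 0, x + t • v ∈ U := by
    have hc : ContinuousAt (fun t : ℝ => x + t • v) 0 := by fun_prop
    exact hc.eventually_mem (hU.mem_nhds (by simpa using hx))
  have hD (w : (Fin n → ℝ) × (Fin n → ℝ)) :=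
    ((heps.hasFDerivAt_fderiv hU hx i k).hasDerivAt_prodMk_add_smul v).clm_apply
      (hasDerivAt_const (0 : ℝ) w)
  have hE (a : Fin n) :=
    (heps.differentiableAt hU hx hx a j).hasFDerivAt.hasDerivAt_prodMk_add_smul v
  have h := (hD (Pi.single j 1, 0)).add
    (HasDerivAt.fun_sum (u := Finset.univ) fun a _ => (hD (0, Pi.single a 1)).mul (hE a))
  refine (h.congr_of_eventuallyEq ?_).congr_deriv ?_
  · filter_upwards [hmem] with t ht
    have hd := heps.differentiableAt hU hx ht i k
    simp only [Pi.add_apply, Pi.mul_apply]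
    rw [← pd_fst_eq_fderiv hd]
    simp only [← pd_snd_eq_fderiv hd]
  · have h₂ (w : (Fin n → ℝ) × (Fin n → ℝ)) := ContinuousLinearMap.sum_apply_zero_single_mul
      ((fderiv ℝ (fderiv ℝ (fun p : (Fin n → ℝ) × (Fin n → ℝ) => eps p.1 p.2 i k))
        (x, x)).flip w) v
    simp only [ContinuousLinearMap.flip_apply] at h₂
    simp only [heps.pd_gam_eq hU hx, heps.gam_eq hU hx, add_mul, Finset.sum_add_distrib,
      Finset.sum_mul, h₂]
    rw [Finset.sum_comm]
    simp only [mul_right_comm _ _ (v _), ← Finset.sum_mul,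
      ContinuousLinearMap.sum_apply_zero_single_mul, zero_smul, add_zero, heps.refl x hx,
      map_zero, mul_ite, mul_one, mul_zero, Finset.sum_ite_eq', Finset.mem_univ, if_true]
    rw [← add_assoc, ← map_add, Prod.mk_add_mk, add_zero, zero_add]
    simp only [mul_comm (fderiv ℝ _ (x, x) (0, v) : ℝ),
      ContinuousLinearMap.sum_apply_zero_single_mul]

end IsSplitting

/-- The algebroid curvature is the linearization of the groupoid
curvature along the diagonal: `(d/dt)|_{t=0} R^i_{jk}(x, x + t v) = 𝔯^i_{jk,a}(x) v^a`.
In particular `R ≡ 0` implies `𝔯 ≡ 0`. -/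
theorem stmt_13 {n : ℕ} (hn : 2 ≤ n) (U : Set (Fin n → ℝ)) (hU : IsOpen U)
    (eps : (Fin n → ℝ) → (Fin n → ℝ) → Fin n → Fin n → ℝ) (heps : IsSplitting U eps) :
    (∀ x ∈ U, ∀ v : Fin n → ℝ, ∀ i j k : Fin n,
        HasDerivAt (fun t : ℝ => Rg eps i j k x (x + t • v))
          (∑ a, ra eps i j k a x * v a) 0) ∧
      ((∀ x ∈ U, ∀ y ∈ U, ∀ i j k : Fin n, Rg eps i j k x y = 0) →
        ∀ x ∈ U, ∀ i j k r : Fin n, ra eps i j k r x = 0) := by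
  have main : ∀ x ∈ U, ∀ v : Fin n → ℝ, ∀ i j k : Fin n,
      HasDerivAt (fun t : ℝ => Rg eps i j k x (x + t • v)) (∑ a, ra eps i j k a x * v a) 0 := by
    intro x hx v i j k
    refine (((heps.hasDerivAt_half_curvature hU hx v i j k).sub
      (heps.hasDerivAt_half_curvature hU hx v i k j)).congr_of_eventuallyEq
        (Filter.Eventually.of_forall fun t => ?_)).congr_deriv ?_
    · simp only [Rg, Pi.sub_apply]
      ring
    · rw [← Finset.sum_sub_distrib]
      refine Finset.sum_congr rfl fun r _ => ?_
      simp only [ra]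
      ring
  refine ⟨main, fun hR x hx i j k r => ?_⟩
  have h := main x hx (Pi.single r 1) i j k
  have hc : ContinuousAt (fun t : ℝ => x + t • (Pi.single r 1 : Fin n → ℝ)) 0 := by fun_prop
  have h0 : (fun t : ℝ => Rg eps i j k x (x + t • Pi.single r 1)) =ᶠ[nhds 0] fun _ => 0 := by
    filter_upwards [hc.eventually_mem (hU.mem_nhds (by simpa using hx))] with t ht
    exact hR x hx _ ht i j k
  have := h.unique ((hasDerivAt_const (0 : ℝ) (0 : ℝ)).congr_of_eventuallyEq h0)
  simpa [Pi.single_apply] using this
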